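/- arXiv:math/9811035 — 2 statements merged into one kernel-verified Lean document; each statement's English description precedes it below -/
import Mathlib

section
/- Let J be a reduced Albert algebra over a field F of characteristic not 2 or 3 and let d ∈ J be rank one (d ≠ 0, d^# = 0). Then the hyperline d×J := {d×k : k ∈ J} is a 10-dimensional F-subspace of J. -/
set_option synthInstance.maxHeartbeats 1000000
set_option maxHeartbeats 1000000

noncomputable section

open scoped TensorProduct

universe u v

structure OctonionAlgebra (F : Type u) [Field F] : Type (max u (v + 1)) where
  C : Type v
  [ringC : NonAssocRing C]
  [modC : Module F C]
  [sccC : SMulCommClass F C C]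
  [istC : IsScalarTower F C C]
  n : QuadraticForm F C
  finrank_eq : Module.finrank F C = 8
  nondeg : ∀ x : C, (∀ y : C, QuadraticMap.polar (⇑n) x y = 0) → x = 0
  n_one : n 1 = 1
  n_mul : ∀ x y : C, n (x * y) = n x * n y

attribute [instance] OctonionAlgebra.ringC OctonionAlgebra.modC OctonionAlgebra.sccC
  OctonionAlgebra.istC

namespace OctonionAlgebra

variable {F : Type u} [Field F] (O : OctonionAlgebra.{u, v} F)

/-- Conjugation `x̄ := n(x,1)•1 - x` (bundled as a linear map; `polarBilin n x 1 = n(x,1)`). -/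
def conj : O.C →ₗ[F] O.C :=
  (LinearMap.toSpanSingleton F O.C (1 : O.C)).comp ((QuadraticMap.polarBilin O.n).flip 1)
    - LinearMap.id

lemma conj_apply (x : O.C) :
    O.conj x = QuadraticMap.polar (⇑O.n) x 1 • (1 : O.C) - x := rfl

/-- A split octonion algebra: the norm form is isotropic. -/
def IsSplit : Prop := ∃ x : O.C, x ≠ 0 ∧ O.n x = 0

end OctonionAlgebra

/-- A reduced Albert algebra `H₃(C,γ)`. -/
structure ReducedAlbert (F : Type u) [Field F] : Type (max u (v + 1)) where
  O : OctonionAlgebra.{u, v} F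
  γ : Fin 3 → Fˣ

namespace ReducedAlbert

variable {F : Type u} [Field F] (A : ReducedAlbert.{u, v} F)

/-- The ambient space of 3×3 matrices over the octonion algebra. -/
abbrev M : Type v := Matrix (Fin 3) (Fin 3) A.O.C

/-- The 27-dimensional space `H₃(C,γ)` of `γ`-hermitian matrices:
`x = γ⁻¹ ⬝ (x̄)ᵀ ⬝ γ`, i.e. entrywise `x i j = γᵢ⁻¹ γⱼ • conj (x j i)`. -/
def J : Submodule F A.M where
  carrier := {x | ∀ i j, x i j = ((A.γ i : F)⁻¹ * (A.γ j : F)) • A.O.conj (x j i)}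
  add_mem' := by
    intro a b ha hb i j
    show a i j + b i j = ((A.γ i : F)⁻¹ * (A.γ j : F)) • A.O.conj (a j i + b j i)
    rw [map_add, smul_add, ← ha i j, ← hb i j]
  zero_mem' := by
    intro i j
    show (0 : A.O.C) = ((A.γ i : F)⁻¹ * (A.γ j : F)) • A.O.conj (0 : A.O.C)
    rw [map_zero, smul_zero]
  smul_mem' := by
    intro c a ha i j
    show c • a i j = ((A.γ i : F)⁻¹ * (A.γ j : F)) • A.O.conj (c • a j i)
    rw [map_smul, smul_comm, ← ha i j]

/-- The Jordan product `x·y := (xy + yx)/2`. -/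
def jmul (x y : A.M) : A.M := (2 : F)⁻¹ • (x * y + y * x)

/-- The trace `T(x)`: the sum of the diagonal entries, which for hermitian matrices are
scalars `ε•1`; the scalar `ε` is recovered as `n(ε•1, 1)/2`. -/
def trace (x : A.M) : F := (2 : F)⁻¹ * ∑ i, QuadraticMap.polar (⇑A.O.n) (x i i) 1

/-- The trace bilinear form `T(x,y) := T(x·y)`. -/
def tb (x y : A.M) : F := A.trace (A.jmul x y)

/-- The adjoint `x ^ # = x·x − T(x)·x + ½(T(x)² − T(x,x))·1`, the unique quadratic map such
that `T(x^#, y)` is the coefficient of `s` in `N(x + s y)`. -/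
def sharp (x : A.M) : A.M :=
  A.jmul x x - A.trace x • x + ((2 : F)⁻¹ * (A.trace x ^ 2 - A.tb x x)) • (1 : A.M)

/-- The Freudenthal cross product `x × y := (x+y)^# − x^# − y^#`. -/
def cross (x y : A.M) : A.M := A.sharp (x + y) - A.sharp x - A.sharp y

/-- The cubic norm `N`, defined pointwise on `J` by
`N(x)·1 = x·(x·x) − T(x)·(x·x) + ½(T(x)² − T(x,x))·x`; the scalar is recovered by
applying the trace (which takes value `3` on `1`). -/
def norm (x : A.M) : F :=
  (3 : F)⁻¹ * A.trace (A.jmul x (A.jmul x x) - A.trace x • A.jmul x x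
    + ((2 : F)⁻¹ * (A.trace x ^ 2 - A.tb x x)) • x)

/-- The operator `⟨x,y⟩(j) := ½ (y × (x × j) − T(j,y)·x − ⅓·T(x,y)·j)`. -/
def brok (x y j : A.M) : A.M :=
  (2 : F)⁻¹ • (A.cross y (A.cross x j) - A.tb j y • x - ((3 : F)⁻¹ * A.tb x y) • j)

/-- `A` is the split Albert algebra `H₃(Cᵈ, 1)`. -/
def IsSplitAlbert : Prop := A.O.IsSplit ∧ ∀ i, A.γ i = 1

/-- A point of `H₃(C,γ)` with coordinates `(ε₀,ε₁,ε₂; a,b,c)`. -/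
def elt (ε : Fin 3 → F) (a b c : A.O.C) : A.M :=
  Matrix.of
    ![![ε 0 • (1 : A.O.C), c, ((A.γ 0 : F)⁻¹ * (A.γ 2 : F)) • A.O.conj b],
      ![((A.γ 1 : F)⁻¹ * (A.γ 0 : F)) • A.O.conj c, ε 1 • (1 : A.O.C), a],
      ![b, ((A.γ 2 : F)⁻¹ * (A.γ 1 : F)) • A.O.conj a, ε 2 • (1 : A.O.C)]]

/-! ### The Brown algebra `B(J, F×F, ζ)` -/

/-- Ambient space of the Brown algebra `B(J, F×F, ζ)`: elements `(α, j; j', β)`. -/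
abbrev Bam : Type (max u v) := F × A.M × A.M × F

/-- The underlying 56-dimensional space of `B(J, F×F, ζ)`: both middle components lie in `J`. -/
def Bsub : Submodule F A.Bam where
  carrier := {p | p.2.1 ∈ A.J ∧ p.2.2.1 ∈ A.J}
  add_mem' := fun ha hb => ⟨A.J.add_mem ha.1 hb.1, A.J.add_mem ha.2 hb.2⟩
  zero_mem' := ⟨A.J.zero_mem, A.J.zero_mem⟩
  smul_mem' := fun c _ h => ⟨A.J.smul_mem c h.1, A.J.smul_mem c h.2⟩

/-- The product of `B(J, F×F, ζ)`. -/
def bmul (ζ : F) (x y : A.Bam) : A.Bam :=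
  (x.1 * y.1 + ζ * A.tb x.2.1 y.2.2.1,
   x.1 • y.2.1 + y.2.2.2 • x.2.1 + ζ • A.cross x.2.2.1 y.2.2.1,
   y.1 • x.2.2.1 + x.2.2.2 • y.2.2.1 + A.cross x.2.1 y.2.1,
   x.2.2.2 * y.2.2.2 + ζ * A.tb y.2.1 x.2.2.1)

/-- The involution `(α,j;j',β)‾ = (β,j;j',α)` of `B(J, F×F, ζ)`. -/
def binv (x : A.Bam) : A.Bam := (x.2.2.2, x.2.1, x.2.2.1, x.1)

/-- The skew-symmetric element `s₀ = (1,0;0,−1)`. -/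
def s0 : A.Bam := (1, 0, 0, -1)

/-- The triple product `{x,y,z} := (x·ȳ)·z + (z·ȳ)·x − (z·x̄)·y` in `B(J, F×F, ζ)`. -/
def brace (ζ : F) (x y z : A.Bam) : A.Bam :=
  A.bmul ζ (A.bmul ζ x (A.binv y)) z + A.bmul ζ (A.bmul ζ z (A.binv y)) x
    - A.bmul ζ (A.bmul ζ z (A.binv x)) y

/-- The bilinear form of the triple system associated to `B(J, F×F, ζ)` and a skew element
`s`: `b(x,y)` is the unique scalar with `b(x,y)•1 = (x·ȳ − y·x̄)·s`; since the unit of the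
algebra is `(1,0;0,1)`, it is the first component of the right-hand side. -/
def bformS (ζ : F) (s x y : A.Bam) : F :=
  (A.bmul ζ (A.bmul ζ x (A.binv y) - A.bmul ζ y (A.binv x)) s).1

/-- The trilinear product of the triple system associated to `B(J, F×F, ζ)` and `s`:
`t(y,z,w) := 2{y, s·z, w} − b(z,w)·y − b(z,y)·w − b(y,w)·z`. -/
def tformS (ζ : F) (s y z w : A.Bam) : A.Bam :=
  (2 : F) • A.brace ζ y (A.bmul ζ s z) w - A.bformS ζ s z w • y - A.bformS ζ s z y • w
    - A.bformS ζ s y w • z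

/-- The bilinear form of the triple system associated to `B(J, F×F, ζ)` and `s₀`. -/
def bform (ζ : F) (x y : A.Bam) : F := A.bformS ζ A.s0 x y

/-- The trilinear product of the triple system associated to `B(J, F×F, ζ)` and `s₀`. -/
def tform (ζ : F) (y z w : A.Bam) : A.Bam := A.tformS ζ A.s0 y z w

/-- `e` is a singular element of `B(J, F×F, ζ)`: `e ≠ 0` and `U_e(B) ⊆ F·e`
where `U_e(x) := {e,x,e}`. -/
def IsSingular (ζ : F) (e : A.Bam) : Prop :=
  e ≠ 0 ∧ ∀ x ∈ A.Bsub, ∃ c : F, A.brace ζ e x e = c • e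

/-- `I` is an inner ideal of `B(J, F×F, ζ)`: a subspace of `B` with `U_e(B) ⊆ I`
for all `e ∈ I`. -/
def IsInnerIdeal (ζ : F) (I : Submodule F A.Bam) : Prop :=
  I ≤ A.Bsub ∧ ∀ e ∈ I, ∀ x ∈ A.Bsub, A.brace ζ e x e ∈ I

end ReducedAlbert

namespace OctonionAlgebra

variable {F : Type u} [Field F] (O : OctonionAlgebra.{u, v} F)

/-- The polar form of the norm, as a bilinear form. -/
abbrev B : LinearMap.BilinForm F O.C := QuadraticMap.polarBilin O.n

lemma n_add (x y : O.C) : O.n (x + y) = O.n x + O.n y + O.B x y := by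
  simp [QuadraticMap.polar]

lemma B_comm (x y : O.C) : O.B x y = O.B y x := by
  simp [QuadraticMap.polar_comm]

lemma B_self (x : O.C) : O.B x x = 2 * O.n x := by
  simp [QuadraticMap.polar_self]

lemma conj_eq (x : O.C) : O.conj x = O.B x 1 • (1 : O.C) - x := rfl

lemma B_ext {x y : O.C} (h : ∀ z, O.B x z = O.B y z) : x = y := by
  rw [← sub_eq_zero]
  refine O.nondeg _ fun z => ?_
  change O.B (x - y) z = 0
  rw [map_sub, LinearMap.sub_apply, h, sub_self]

lemma B_mul_left (x y z : O.C) : O.B (x * y) (x * z) = O.n x * O.B y z := by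
  have h := O.n_add (x * y) (x * z)
  rw [← mul_add, O.n_mul, O.n_mul, O.n_mul, O.n_add] at h
  linear_combination -h

lemma B_mul_right (x y z : O.C) : O.B (y * x) (z * x) = O.n x * O.B y z := by
  have h := O.n_add (y * x) (z * x)
  rw [← add_mul, O.n_mul, O.n_mul, O.n_mul, O.n_add] at h
  linear_combination -h

lemma B_mul_add (x y z w : O.C) :
    O.B (x * y) (z * w) + O.B (x * w) (z * y) = O.B x z * O.B y w := by
  have h := O.B_mul_left (x + z) y w
  have h1 := O.B_mul_left x y w
  have h2 := O.B_mul_left z y w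
  rw [add_mul, add_mul, O.n_add] at h
  simp only [map_add, LinearMap.add_apply] at h
  rw [O.B_comm (x * w)]
  linear_combination h - h1 - h2

lemma B_mul_eq_right (x y z : O.C) : O.B (x * y) z = O.B y (O.conj x * z) := by
  have h := O.B_mul_add x y 1 z
  simp only [one_mul] at h
  rw [conj_eq, sub_mul, smul_mul_assoc, one_mul, map_sub, map_smul, smul_eq_mul,
    O.B_comm y (x * z)]
  linear_combination h

lemma B_mul_eq_left (x y z : O.C) : O.B (x * y) z = O.B x (z * O.conj y) := by
  have h := O.B_mul_add x y z 1
  simp only [mul_one] at h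
  rw [conj_eq, mul_sub, mul_smul_comm, mul_one, map_sub, map_smul, smul_eq_mul]
  linear_combination h

lemma B_one_one : O.B 1 1 = 2 := by
  rw [B_self, O.n_one, mul_one]

@[simp] lemma conj_one : O.conj 1 = 1 := by
  rw [conj_eq, B_one_one, two_smul, add_sub_cancel_right]

@[simp] lemma conj_conj (x : O.C) : O.conj (O.conj x) = x := by
  rw [O.conj_eq x, map_sub, map_smul, conj_one, O.conj_eq x, sub_sub_cancel]

lemma B_conj_left (x y : O.C) : O.B (O.conj x) y = O.B x (O.conj y) := by
  simp only [conj_eq, map_sub, map_smul, LinearMap.sub_apply, LinearMap.smul_apply, smul_eq_mul,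
    O.B_comm 1 y]
  ring

lemma n_conj (x : O.C) : O.n (O.conj x) = O.n x := by
  have h := O.n_add (O.B x 1 • 1) (-x)
  rw [conj_eq, sub_eq_add_neg, h, QuadraticMap.map_smul, O.n_one, QuadraticMap.map_neg,
    map_neg, map_smul, LinearMap.smul_apply, O.B_comm 1, smul_eq_mul]
  ring

@[simp] lemma conj_mul (x y : O.C) : O.conj (x * y) = O.conj y * O.conj x := by
  refine O.B_ext fun z => ?_
  rw [O.B_mul_eq_right (O.conj y), conj_conj, O.B_comm (O.conj x), B_mul_eq_left, O.B_comm y,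
    B_mul_eq_right, conj_conj, O.B_comm _ (x * y), B_conj_left]

lemma conj_mul_mul (x y : O.C) : O.conj x * (x * y) = O.n x • y := by
  refine O.B_ext fun z => ?_
  rw [B_mul_eq_right, conj_conj, B_mul_left, map_smul, LinearMap.smul_apply, smul_eq_mul]

lemma mul_mul_conj (x y : O.C) : (y * x) * O.conj x = O.n x • y := by
  refine O.B_ext fun z => ?_
  rw [B_mul_eq_left, conj_conj, B_mul_right, map_smul, LinearMap.smul_apply, smul_eq_mul]

lemma conj_mul_mul_add (x z y : O.C) :
    O.conj x * (z * y) + O.conj z * (x * y) = O.B x z • y := by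
  have h := O.conj_mul_mul (x + z) y
  rw [O.n_add, map_add] at h
  simp only [add_mul, mul_add, add_smul, O.conj_mul_mul] at h
  linear_combination (norm := module) h

lemma mul_mul_conj_add (x z y : O.C) :
    (y * x) * O.conj z + (y * z) * O.conj x = O.B x z • y := by
  have h := O.mul_mul_conj (x + z) y
  rw [O.n_add, map_add] at h
  simp only [add_mul, mul_add, add_smul, O.mul_mul_conj] at h
  linear_combination (norm := module) h

lemma conj_mul_self (x : O.C) : O.conj x * x = O.n x • (1 : O.C) := by
  simpa using O.conj_mul_mul x 1

lemma mul_conj_self (x : O.C) : x * O.conj x = O.n x • (1 : O.C) := by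
  simpa using O.mul_mul_conj x 1

lemma B_conj_mul_conj_left (x y z : O.C) :
    O.B (O.conj y * O.conj x) z = O.B x (O.conj z * O.conj y) := by
  rw [← conj_mul, B_conj_left, B_mul_eq_left]

lemma B_conj_mul_conj_right (x y z : O.C) :
    O.B (O.conj y * O.conj x) z = O.B y (O.conj x * O.conj z) := by
  rw [← conj_mul, B_conj_left, B_mul_eq_right]

/-- Coordinates `(ε₀, ε₁, ε₂, a, b, c)` of the hermitian matrices over `O`. -/
abbrev Coord : Type (max u v) := F × F × F × O.C × O.C × O.C

/-- The adjoint in coordinates, with parameters `g₀, g₁, g₂`. -/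
def adj (g0 g1 g2 : F) : O.Coord → O.Coord := fun (e0, e1, e2, a, b, c) =>
  (e1 * e2 - g1 * g2 * O.n a, e2 * e0 - g2 * g0 * O.n b, e0 * e1 - g0 * g1 * O.n c,
    g0 • O.conj (b * c) - e0 • a, g1 • O.conj (c * a) - e1 • b, g2 • O.conj (a * b) - e2 • c)

/-- The Freudenthal product in coordinates. -/
def adjCross (g0 g1 g2 : F) (d : O.Coord) : O.Coord →ₗ[F] O.Coord where
  toFun := match d with
    | (d0, d1, d2, a, b, c) => fun (k0, k1, k2, p, q, r) =>
      (d1 * k2 + k1 * d2 - g1 * g2 * O.B a p, d2 * k0 + k2 * d0 - g2 * g0 * O.B b q,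
        d0 * k1 + k0 * d1 - g0 * g1 * O.B c r,
        g0 • (O.conj (b * r) + O.conj (q * c)) - d0 • p - k0 • a,
        g1 • (O.conj (c * p) + O.conj (r * a)) - d1 • q - k1 • b,
        g2 • (O.conj (a * q) + O.conj (p * b)) - d2 • r - k2 • c)
  map_add' := by
    obtain ⟨d0, d1, d2, a, b, c⟩ := d
    rintro ⟨k0, k1, k2, p, q, r⟩ ⟨l0, l1, l2, s, t, w⟩
    simp only [Prod.mk_add_mk, Prod.mk.injEq, mul_add, add_mul, map_add]
    refine ⟨by ring, by ring, by ring, by module, by module, by module⟩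
  map_smul' := by
    obtain ⟨d0, d1, d2, a, b, c⟩ := d
    rintro m ⟨k0, k1, k2, p, q, r⟩
    simp only [Prod.smul_mk, Prod.mk.injEq, mul_smul_comm, smul_mul_assoc, map_smul, smul_eq_mul,
      RingHom.id_apply]
    refine ⟨by ring, by ring, by ring, by module, by module, by module⟩

lemma adjCross_apply (g0 g1 g2 : F) (d k : O.Coord) :
    O.adjCross g0 g1 g2 d k = O.adj g0 g1 g2 (d + k) - O.adj g0 g1 g2 d - O.adj g0 g1 g2 k := by
  obtain ⟨d0, d1, d2, a, b, c⟩ := d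
  obtain ⟨k0, k1, k2, p, q, r⟩ := k
  simp only [adjCross, adj, LinearMap.coe_mk, AddHom.coe_mk, Prod.mk_sub_mk,
    Prod.mk.injEq, mul_add, add_mul, map_add, n_add]
  refine ⟨by ring, by ring, by ring, by module, by module, by module⟩

lemma finrank_range_adjCross_eq {g0 g1 g2 h0 h1 h2 : F} (L M : O.Coord →ₗ[F] O.Coord)
    (hL : Function.Surjective L) (hM : Function.Injective M)
    (h : ∀ x, O.adj h0 h1 h2 (L x) = M (O.adj g0 g1 g2 x)) (d : O.Coord) :
    Module.finrank F (LinearMap.range (O.adjCross g0 g1 g2 d)) =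
      Module.finrank F (LinearMap.range (O.adjCross h0 h1 h2 (L d))) := by
  have key : (O.adjCross h0 h1 h2 (L d)).comp L = M.comp (O.adjCross g0 g1 g2 d) := by
    refine LinearMap.ext fun x => ?_
    simp only [LinearMap.comp_apply, adjCross_apply, ← map_add, h, map_sub]
  rw [← LinearMap.range_comp_of_range_eq_top (O.adjCross h0 h1 h2 (L d))
    (LinearMap.range_eq_top.2 hL), key, LinearMap.range_comp]
  exact (Submodule.equivMapOfInjective M hM _).finrank_eq

instance : Module.Finite F O.C :=
  Module.finite_of_finrank_pos (by rw [O.finrank_eq]; norm_num)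

lemma finrank_range_adjCross_of_ne_zero {g0 g1 g2 d0 d1 d2 : F} {a b c : O.C} (h0 : d0 ≠ 0)
    (h : O.adj g0 g1 g2 (d0, d1, d2, a, b, c) = 0) :
    Module.finrank F (LinearMap.range (O.adjCross g0 g1 g2 (d0, d1, d2, a, b, c))) = 10 := by
  simp only [adj, Prod.mk_eq_zero, conj_mul, sub_eq_zero] at h
  obtain ⟨e0, e1, e2, ea, eb, ec⟩ := h
  let π : O.Coord →ₗ[F] F × F × O.C :=
    { toFun := fun x => (x.2.1, x.2.2.1, x.2.2.2.1)
      map_add' := fun _ _ => rfl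
      map_smul' := fun _ _ => rfl }
  have inj : ∀ k, π (O.adjCross g0 g1 g2 (d0, d1, d2, a, b, c) k) = 0 →
      O.adjCross g0 g1 g2 (d0, d1, d2, a, b, c) k = 0 := by
    rintro ⟨k0, k1, k2, p, q, r⟩ hk
    simp only [π, adjCross, LinearMap.coe_mk, AddHom.coe_mk, Prod.mk_eq_zero, conj_mul] at hk ⊢
    obtain ⟨x1, x2, xa⟩ := hk
    refine ⟨?_, x1, x2, xa, ?_, ?_⟩
    · have xa' := congrArg (O.B a) xa
      have eb' := congrArg (fun y => O.B y q) eb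
      have ec' := congrArg (fun y => O.B y r) ec
      simp only [map_add, map_sub, map_smul, LinearMap.smul_apply, smul_eq_mul, map_zero,
        O.B_self] at xa' eb' ec'
      rw [B_conj_mul_conj_right] at eb'
      rw [B_conj_mul_conj_left] at ec'
      refine (mul_eq_zero.1 ?_).resolve_left h0
      linear_combination d1 * x1 + d2 * x2 + g1 * g2 * xa' - 2 * k0 * e0 - g0 * g2 * eb'
        - g0 * g1 * ec'
    · have xa' := congrArg (fun y => O.conj (c * y)) xa
      have ea' := congrArg (fun y => O.conj (r * y)) ea
      simp only [map_add, map_sub, map_smul, conj_mul, conj_conj, mul_add, mul_sub, map_zero,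
        mul_zero, mul_smul_comm] at xa' ea'
      refine (smul_eq_zero_iff_right h0).1 ?_
      linear_combination (norm := module) (g1 * g0) • O.mul_mul_conj_add c r b
        + (g1 * g0) • O.mul_mul_conj c q - g1 • xa' - g1 • ea' - e2 • q - k0 • eb - x2 • b
    · have xa' := congrArg (fun y => O.conj (y * b)) xa
      have ea' := congrArg (fun y => O.conj (y * q)) ea
      simp only [map_add, map_sub, map_smul, conj_mul, conj_conj, map_zero, add_mul, sub_mul,
        zero_mul, smul_mul_assoc] at xa' ea'
      refine (smul_eq_zero_iff_right h0).1 ?_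
      linear_combination (norm := module) (g2 * g0) • O.conj_mul_mul_add b q c
        + (g2 * g0) • O.conj_mul_mul b r - g2 • xa' - g2 • ea' - e1 • r - k0 • ec - x1 • c
  have surj : Function.Surjective
      (π.domRestrict (LinearMap.range (O.adjCross g0 g1 g2 (d0, d1, d2, a, b, c)))) := by
    rintro ⟨x1, x2, y⟩
    refine ⟨⟨_, (0, d0⁻¹ * x2, d0⁻¹ * x1, -d0⁻¹ • y, 0, 0), rfl⟩, ?_⟩
    refine Eq.trans (LinearMap.domRestrict_apply _ _ _) ?_
    simp only [π, adjCross, LinearMap.coe_mk, AddHom.coe_mk, Prod.mk.injEq, map_zero,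
      mul_zero, zero_mul, add_zero, smul_zero, zero_smul, sub_zero, zero_add]
    exact ⟨by field_simp, by field_simp, by simp [smul_smul, h0]⟩
  have inj' : Function.Injective
      (π.domRestrict (LinearMap.range (O.adjCross g0 g1 g2 (d0, d1, d2, a, b, c)))) := by
    rw [injective_iff_map_eq_zero]
    rintro ⟨_, k, rfl⟩ hk
    exact Subtype.ext (inj k hk)
  rw [(LinearEquiv.ofBijective _ ⟨inj', surj⟩).finrank_eq, Module.finrank_prod,
    Module.finrank_prod, Module.finrank_self, O.finrank_eq]

/-- Cyclic rotation of the coordinates. -/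
def rotate : O.Coord →ₗ[F] O.Coord where
  toFun := fun (e0, e1, e2, a, b, c) => (e1, e2, e0, b, c, a)
  map_add' _ _ := rfl
  map_smul' _ _ := rfl

lemma rotate_bijective : Function.Bijective O.rotate :=
  Function.bijective_iff_has_inverse.2
    ⟨fun (e0, e1, e2, a, b, c) => (e2, e0, e1, c, a, b), fun _ => rfl, fun _ => rfl⟩

lemma adj_rotate (g0 g1 g2 : F) (x : O.Coord) :
    O.adj g1 g2 g0 (O.rotate x) = O.rotate (O.adj g0 g1 g2 x) := rfl

lemma finrank_range_adjCross_rotate (g0 g1 g2 : F) (d : O.Coord) :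
    Module.finrank F (LinearMap.range (O.adjCross g0 g1 g2 d)) =
      Module.finrank F (LinearMap.range (O.adjCross g1 g2 g0 (O.rotate d))) :=
  O.finrank_range_adjCross_eq O.rotate O.rotate O.rotate_bijective.2 O.rotate_bijective.1
    (O.adj_rotate g0 g1 g2) d

/-- An elementary transvection, which preserves the cubic norm. -/
def transvection (g1 g2 : F) (u : O.C) : O.Coord →ₗ[F] O.Coord where
  toFun := fun (e0, e1, e2, a, b, c) =>
    (e0, e1 + g1 * g2 * (O.B a u + O.n u * e2), e2, a + e2 • u, b, c + g2 • O.conj (u * b))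
  map_add' := by
    rintro ⟨k0, k1, k2, p, q, r⟩ ⟨l0, l1, l2, s, t, w⟩
    simp only [Prod.mk_add_mk, Prod.mk.injEq, mul_add, map_add, LinearMap.add_apply]
    refine ⟨trivial, by ring, trivial, by module, trivial, by module⟩
  map_smul' := by
    rintro m ⟨k0, k1, k2, p, q, r⟩
    simp only [Prod.smul_mk, Prod.mk.injEq, mul_smul_comm, map_smul, smul_eq_mul,
      LinearMap.smul_apply, RingHom.id_apply]
    refine ⟨trivial, by ring, trivial, by module, trivial, by module⟩

/-- The action on adjoints induced by `transvection`. -/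
def cotransvection (g1 g2 : F) (u : O.C) : O.Coord →ₗ[F] O.Coord where
  toFun := fun (f0, f1, f2, p, q, r) =>
    (f0, f1, f2 + g1 * g2 * (O.n u * f1 - O.B p u), p - f1 • u, q - g1 • O.conj (r * u), r)
  map_add' := by
    rintro ⟨k0, k1, k2, p, q, r⟩ ⟨l0, l1, l2, s, t, w⟩
    simp only [Prod.mk_add_mk, Prod.mk.injEq, mul_add, add_mul, map_add, LinearMap.add_apply]
    refine ⟨trivial, trivial, by ring, by module, by module, trivial⟩
  map_smul' := by
    rintro m ⟨k0, k1, k2, p, q, r⟩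
    simp only [Prod.smul_mk, Prod.mk.injEq, smul_mul_assoc, map_smul, smul_eq_mul,
      LinearMap.smul_apply, RingHom.id_apply]
    refine ⟨trivial, trivial, by ring, by module, by module, trivial⟩

lemma transvection_surjective (g1 g2 : F) (u : O.C) :
    Function.Surjective (O.transvection g1 g2 u) := by
  rintro ⟨e0, e1, e2, a, b, c⟩
  refine ⟨(e0, e1 - g1 * g2 * (O.B (a - e2 • u) u + O.n u * e2), e2, a - e2 • u, b,
    c - g2 • O.conj (u * b)), ?_⟩
  simp only [transvection, LinearMap.coe_mk, AddHom.coe_mk, sub_add_cancel]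

lemma cotransvection_injective (g1 g2 : F) (u : O.C) :
    Function.Injective (O.cotransvection g1 g2 u) := by
  rintro ⟨k0, k1, k2, p, q, r⟩ ⟨l0, l1, l2, s, t, w⟩ h
  simp only [cotransvection, LinearMap.coe_mk, AddHom.coe_mk, Prod.mk.injEq] at h
  obtain ⟨rfl, rfl, e2, ea, eb, rfl⟩ := h
  obtain rfl := sub_left_injective ea
  obtain rfl := sub_left_injective eb
  obtain rfl := add_left_injective _ e2
  rfl

lemma adj_transvection (g0 g1 g2 : F) (u : O.C) (x : O.Coord) :
    O.adj g0 g1 g2 (O.transvection g1 g2 u x) = O.cotransvection g1 g2 u (O.adj g0 g1 g2 x) := by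
  obtain ⟨e0, e1, e2, a, b, c⟩ := x
  simp only [transvection, cotransvection, adj, LinearMap.coe_mk, AddHom.coe_mk, Prod.mk.injEq,
    conj_mul, map_add, map_smul, conj_conj, mul_add, add_mul, mul_sub, smul_mul_assoc,
    mul_smul_comm, map_sub, n_add, QuadraticMap.map_smul, O.n_mul, n_conj, smul_eq_mul,
    LinearMap.sub_apply, LinearMap.smul_apply, B_conj_mul_conj_right]
  refine ⟨by ring, trivial, by ring, ?_, ?_, ?_⟩
  · linear_combination (norm := module) (g0 * g2) • O.mul_mul_conj b u
  · linear_combination (norm := module) (g1 * g2) • O.conj_mul_mul_add a u b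
      + (g1 * g2 * e2) • O.conj_mul_mul u b
  · module

lemma finrank_range_adjCross {g0 g1 g2 : F} (hg0 : g0 ≠ 0) (hg1 : g1 ≠ 0) (hg2 : g2 ≠ 0)
    {d : O.Coord} (hd : d ≠ 0) (h : O.adj g0 g1 g2 d = 0) :
    Module.finrank F (LinearMap.range (O.adjCross g0 g1 g2 d)) = 10 := by
  have of_snd : ∀ {g0 g1 g2 : F} {d : O.Coord}, d.2.1 ≠ 0 → O.adj g0 g1 g2 d = 0 →
      Module.finrank F (LinearMap.range (O.adjCross g0 g1 g2 d)) = 10 := by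
    intro g0 g1 g2 d hd h
    rw [finrank_range_adjCross_rotate]
    refine O.finrank_range_adjCross_of_ne_zero hd ?_
    exact (O.adj_rotate g0 g1 g2 d).trans (by rw [h, map_zero])
  have of_a : ∀ {g0 g1 g2 : F}, g1 ≠ 0 → g2 ≠ 0 → ∀ {d : O.Coord}, d.2.2.2.1 ≠ 0 →
      O.adj g0 g1 g2 d = 0 →
      Module.finrank F (LinearMap.range (O.adjCross g0 g1 g2 d)) = 10 := by
    intro g0 g1 g2 hg1 hg2 d hd h
    by_cases h1 : d.2.1 = 0
    swap
    · exact of_snd h1 h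
    by_cases h2 : d.2.2.1 = 0
    swap
    · rw [finrank_range_adjCross_rotate]
      exact of_snd h2 ((O.adj_rotate g0 g1 g2 d).trans (by rw [h, map_zero]))
    obtain ⟨u, hu⟩ : ∃ u, O.B d.2.2.2.1 u ≠ 0 := by
      by_contra! hu
      exact hd (O.nondeg _ hu)
    rw [O.finrank_range_adjCross_eq _ _ (O.transvection_surjective g1 g2 u)
      (O.cotransvection_injective g1 g2 u) (O.adj_transvection g0 g1 g2 u)]
    refine of_snd ?_ (by rw [adj_transvection, h, map_zero])
    change d.2.1 + g1 * g2 * (O.B d.2.2.2.1 u + O.n u * d.2.2.1) ≠ 0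
    rw [h1, h2, zero_add, mul_zero, add_zero]
    exact mul_ne_zero (mul_ne_zero hg1 hg2) hu
  have hr : O.adj g1 g2 g0 (O.rotate d) = 0 := by rw [adj_rotate, h, map_zero]
  have hrr : O.adj g2 g0 g1 (O.rotate (O.rotate d)) = 0 := by rw [adj_rotate, hr, map_zero]
  have ha := of_a (g0 := g0) (d := d) hg1 hg2
  have hb := of_a (g0 := g1) (d := O.rotate d) hg2 hg0
  have hc := of_a (g0 := g2) (d := O.rotate (O.rotate d)) hg0 hg1
  have h1 := of_snd (d := d) (g0 := g0) (g1 := g1) (g2 := g2)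
  have h2 := of_snd (d := O.rotate d) (g0 := g1) (g1 := g2) (g2 := g0)
  have h0 := of_snd (d := O.rotate (O.rotate d)) (g0 := g2) (g1 := g0) (g2 := g1)
  simp only [← finrank_range_adjCross_rotate] at hb hc h2 h0
  by_contra! hn
  refine hd (Prod.ext ?_ (Prod.ext ?_ (Prod.ext ?_ (Prod.ext ?_ (Prod.ext ?_ ?_)))))
  · exact by_contra fun hx => hn (h0 hx hrr)
  · exact by_contra fun hx => hn (h1 hx h)
  · exact by_contra fun hx => hn (h2 hx hr)
  · exact by_contra fun hx => hn (ha hx h)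
  · exact by_contra fun hx => hn (hb hx hr)
  · exact by_contra fun hx => hn (hc hx hrr)

end OctonionAlgebra

namespace ReducedAlbert

variable {F : Type u} [Field F] (A : ReducedAlbert.{u, v} F)

/-- The hermitian matrix with given coordinates. -/
def ofCoord : A.O.Coord →ₗ[F] A.M where
  toFun := fun (e0, e1, e2, a, b, c) => Matrix.of
    ![![e0 • 1, (A.γ 1 : F) • c, (A.γ 2 : F) • A.O.conj b],
      ![(A.γ 0 : F) • A.O.conj c, e1 • 1, (A.γ 2 : F) • a],
      ![(A.γ 0 : F) • b, (A.γ 1 : F) • A.O.conj a, e2 • 1]]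
  map_add' := by
    rintro ⟨k0, k1, k2, p, q, r⟩ ⟨l0, l1, l2, s, t, w⟩
    ext i j
    fin_cases i <;> fin_cases j <;> simp [add_smul]
  map_smul' := by
    rintro m ⟨k0, k1, k2, p, q, r⟩
    ext i j
    fin_cases i <;> fin_cases j <;> simp [mul_smul, smul_comm m]

lemma ofCoord_injective : Function.Injective A.ofCoord := by
  rw [injective_iff_map_eq_zero]
  rintro ⟨e0, e1, e2, a, b, c⟩ h
  have h1 : (1 : A.O.C) ≠ 0 := by
    intro h1
    have := A.O.n_one
    rw [h1, QuadraticMap.map_zero] at this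
    exact zero_ne_one this
  have e (i j) := congrFun (congrFun h i) j
  have h00 : e0 • (1 : A.O.C) = 0 := e 0 0
  have h11 : e1 • (1 : A.O.C) = 0 := e 1 1
  have h22 : e2 • (1 : A.O.C) = 0 := e 2 2
  have h12 : (A.γ 2 : F) • a = 0 := e 1 2
  have h20 : (A.γ 0 : F) • b = 0 := e 2 0
  have h01 : (A.γ 1 : F) • c = 0 := e 0 1
  simp only [smul_eq_zero, h1, Units.ne_zero, or_false, false_or] at h00 h11 h22 h12 h20 h01
  simp [*]

lemma range_ofCoord (h2 : (2 : F) ≠ 0) : LinearMap.range A.ofCoord = A.J := by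
  apply le_antisymm
  · rintro _ ⟨⟨e0, e1, e2, a, b, c⟩, rfl⟩ i j
    have hγ (i j) : (A.γ i : F)⁻¹ * A.γ j * A.γ i = A.γ j := by
      rw [mul_right_comm, inv_mul_cancel₀ (A.γ i).ne_zero, one_mul]
    fin_cases i <;> fin_cases j <;> simp [ofCoord, smul_smul, hγ]
  · intro x hx
    have diag (i : Fin 3) : ∃ e : F, x i i = e • 1 := by
      refine ⟨2⁻¹ * A.O.B (x i i) 1, ?_⟩
      have h := hx i i
      rw [inv_mul_cancel₀ (A.γ i).ne_zero, one_smul, A.O.conj_eq, eq_sub_iff_add_eq,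
        ← two_smul F] at h
      rw [mul_smul, ← h, inv_smul_smul₀ h2]
    choose e he using diag
    refine ⟨(e 0, e 1, e 2, (A.γ 2 : F)⁻¹ • x 1 2, (A.γ 0 : F)⁻¹ • x 2 0,
      (A.γ 1 : F)⁻¹ • x 0 1), ?_⟩
    have h02 := hx 0 2
    have h10 := hx 1 0
    have h21 := hx 2 1
    ext i j
    fin_cases i <;> fin_cases j <;>
      simp [ofCoord, smul_smul, ← he, h02, h10, h21, mul_comm]

lemma sharp_ofCoord (h2 : (2 : F) ≠ 0) (x : A.O.Coord) :
    A.sharp (A.ofCoord x) = A.ofCoord (A.O.adj (A.γ 0) (A.γ 1) (A.γ 2) x) := by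
  obtain ⟨e0, e1, e2, a, b, c⟩ := x
  have hj (x : A.M) : A.jmul x x = x * x := by
    rw [jmul, ← two_smul F, inv_smul_smul₀ h2]
  have ht (x : A.M) : A.trace x = 2⁻¹ * (A.O.B (x 0 0) 1 + A.O.B (x 1 1) 1 + A.O.B (x 2 2) 1) := by
    rw [trace, Fin.sum_univ_three]
    rfl
  rw [sharp, tb, hj]
  ext i j
  fin_cases i <;> fin_cases j <;>
    simp [ofCoord, OctonionAlgebra.adj, ht, A.O.B_one_one, mul_smul_comm,
      A.O.mul_conj_self, A.O.conj_mul_self, -QuadraticMap.polarBilin_apply_apply] <;>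
    match_scalars <;> field_simp <;> ring

end ReducedAlbert

/-- For a rank-one element `d` of a reduced Albert algebra `J`, the
hyperline `d × J = {d × k : k ∈ J}` is a 10-dimensional `F`-subspace of `J`. -/
theorem stmt14 {F : Type u} [Field F] (h2 : (2 : F) ≠ 0) (h3 : (3 : F) ≠ 0)
    (A : ReducedAlbert.{u, v} F) (d : A.M) (hd : d ∈ A.J) (hd0 : d ≠ 0)
    (hdsharp : A.sharp d = 0) :
    ∃ W : Submodule F A.M,
      (W : Set A.M) = {x : A.M | ∃ k ∈ A.J, x = A.cross d k} ∧
      Module.finrank F W = 10 := by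
  have hr := A.range_ofCoord h2
  obtain ⟨x, rfl⟩ : d ∈ LinearMap.range A.ofCoord := hr ▸ hd
  have hx0 : x ≠ 0 := by
    rintro rfl
    exact hd0 (map_zero _)
  have hx : A.O.adj (A.γ 0) (A.γ 1) (A.γ 2) x = 0 := by
    apply A.ofCoord_injective
    rw [← A.sharp_ofCoord h2, hdsharp, map_zero]
  have hcross (y : A.O.Coord) : A.cross (A.ofCoord x) (A.ofCoord y) =
      A.ofCoord (A.O.adjCross (A.γ 0) (A.γ 1) (A.γ 2) x y) := by
    simp only [ReducedAlbert.cross, ← map_add, A.sharp_ofCoord h2,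
      OctonionAlgebra.adjCross_apply, map_sub]
  refine ⟨(LinearMap.range (A.O.adjCross (A.γ 0) (A.γ 1) (A.γ 2) x)).map A.ofCoord, ?_, ?_⟩
  · ext z
    constructor
    · rintro ⟨_, ⟨y, rfl⟩, rfl⟩
      exact ⟨A.ofCoord y, hr ▸ ⟨y, rfl⟩, (hcross y).symm⟩
    · rintro ⟨k, hk, rfl⟩
      obtain ⟨y, rfl⟩ : k ∈ LinearMap.range A.ofCoord := hr ▸ hk
      exact ⟨_, ⟨y, rfl⟩, (hcross y).symm⟩
  · rw [← (Submodule.equivMapOfInjective _ A.ofCoord_injective _).finrank_eq]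
    exact A.O.finrank_range_adjCross (A.γ 0).ne_zero (A.γ 1).ne_zero (A.γ 2).ne_zero hx0 hx
end
end

section
/- Let J be a reduced Albert algebra over a field F of characteristic not 2 or 3 and let I be an inner ideal of B(J,F×F). If I contains the subspace {(0, 0; j', 0) : j' ∈ J} or the subspace {(0, j; 0, 0) : j ∈ J}, then I = B(J,F×F). -/
set_option synthInstance.maxHeartbeats 1000000
set_option maxHeartbeats 1000000

noncomputable section

open scoped TensorProduct

universe u v

namespace ReducedAlbert

section Identities

variable {F : Type u} [Field F] (A : ReducedAlbert.{u, v} F)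

lemma one_mem_J : (1 : A.M) ∈ A.J := by
  intro i j
  by_cases h : i = j
  · subst h
    simp [Matrix.one_apply_eq, OctonionAlgebra.conj_apply, A.O.n_one]
    module
  · simp [Matrix.one_apply_ne h, Matrix.one_apply_ne (Ne.symm h)]

lemma trace_add (x y : A.M) : A.trace (x + y) = A.trace x + A.trace y := by
  simp only [trace, Matrix.add_apply, QuadraticMap.polar_add_left, Finset.sum_add_distrib, mul_add]

lemma trace_smul (c : F) (x : A.M) : A.trace (c • x) = c * A.trace x := by
  simp only [trace, Matrix.smul_apply, QuadraticMap.polar_smul_left, Finset.mul_sum, smul_eq_mul]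
  exact Finset.sum_congr rfl fun _ _ => by ring

lemma trace_zero : A.trace 0 = 0 := by
  simpa using A.trace_smul 0 0

lemma tb_zero_left (x : A.M) : A.tb 0 x = 0 := by
  simp [tb, jmul, trace_zero]

lemma tb_zero_right (x : A.M) : A.tb x 0 = 0 := by
  simp [tb, jmul, trace_zero]

lemma sharp_zero : A.sharp 0 = 0 := by
  simp [sharp, tb_zero_left, trace_zero, jmul]

lemma cross_zero_left (x : A.M) : A.cross 0 x = 0 := by
  simp [cross, sharp_zero]

lemma cross_zero_right (x : A.M) : A.cross x 0 = 0 := by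
  simp [cross, sharp_zero]

lemma jmul_smul_smul (c : F) (x : A.M) : A.jmul (c • x) (c • x) = c ^ 2 • A.jmul x x := by
  simp only [jmul, smul_mul_assoc, mul_smul_comm, smul_add, smul_smul]
  congr 2 <;> ring

lemma sharp_smul (c : F) (x : A.M) : A.sharp (c • x) = c ^ 2 • A.sharp x := by
  simp only [sharp, tb, jmul_smul_smul, trace_smul]
  module

lemma cross_self (x : A.M) : A.cross x x = (2 : F) • A.sharp x := by
  rw [cross, ← two_smul F x, sharp_smul]
  module

lemma trace_one (h2 : (2 : F) ≠ 0) : A.trace 1 = 3 := by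
  simp [trace, A.O.n_one]
  field_simp

lemma jmul_one (h2 : (2 : F) ≠ 0) (x : A.M) : A.jmul x 1 = x := by
  rw [jmul, mul_one, one_mul, ← two_smul F x, smul_smul, inv_mul_cancel₀ h2, one_smul]

lemma jmul_add_one (h2 : (2 : F) ≠ 0) (x : A.M) :
    A.jmul (x + 1) (x + 1) = A.jmul x x + (2 : F) • x + 1 := by
  have h : (x + 1) * (x + 1) + (x + 1) * (x + 1) = (x * x + x * x) + (4 : F) • x + (2 : F) • 1 := by
    rw [add_mul, mul_add, mul_one, one_mul]
    module
  rw [jmul, jmul, h, smul_add, smul_add, smul_smul, smul_smul, inv_mul_cancel₀ h2, one_smul]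
  congr 3
  field_simp
  norm_num

lemma sharp_one (h2 : (2 : F) ≠ 0) : A.sharp 1 = 1 := by
  simp only [sharp, tb, jmul_one A h2, trace_one A h2]
  match_scalars
  field_simp
  norm_num

/-- Equivalent to the identity `x × 1 = T(x)·1 − x`. -/
lemma sharp_add_one (h2 : (2 : F) ≠ 0) (x : A.M) :
    A.sharp (x + 1) = A.sharp x + A.trace x • (1 : A.M) - x + 1 := by
  simp only [sharp, tb, jmul_add_one A h2, trace_add, trace_smul, trace_one A h2]
  match_scalars <;> field_simp <;> ring

lemma tb_cross_one_one (h2 : (2 : F) ≠ 0) : A.tb (A.cross 1 1) 1 = 6 := by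
  rw [cross_self, sharp_one A h2, tb, jmul_one A h2, trace_smul, trace_one A h2]
  norm_num

/-- Linear combinations of adjoints exhaust `J`. -/
lemma J_le_of_sharp_mem (h2 : (2 : F) ≠ 0) (P : Submodule F A.M) (hP : ∀ j ∈ A.J, A.sharp j ∈ P) : A.J ≤ P := by
  intro j hj
  have h1 : (1 : A.M) ∈ P := by
    rw [← sharp_one A h2]
    exact hP 1 A.one_mem_J
  have h : j = A.sharp j + A.trace j • (1 : A.M) + 1 - A.sharp (j + 1) := by
    rw [sharp_add_one A h2]
    abel
  rw [h]
  exact P.sub_mem (P.add_mem (P.add_mem (hP j hj) (P.smul_mem _ h1)) h1)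
    (hP _ (A.J.add_mem hj A.one_mem_J))

lemma brace_lower_scalar (j : A.M) :
    A.brace 1 (0, 0, j, 0) (0, 0, 0, 1) (0, 0, j, 0) = (0, A.cross j j, 0, 0) := by
  simp [brace, bmul, binv, cross_zero_right, tb_zero_left, tb_zero_right]
  rfl

lemma brace_lower_lower (j k : A.M) :
    A.brace 1 (0, 0, j, 0) (0, 0, k, 0) (0, 0, j, 0) =
      (2 * A.tb (A.cross j k) j - A.tb (A.cross j j) k, 0, 0, 0) := by
  simp [brace, bmul, binv, cross_zero_left, cross_zero_right, tb_zero_left, tb_zero_right, two_mul]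
  rfl

lemma brace_upper_scalar (j : A.M) :
    A.brace 1 (0, j, 0, 0) (1, 0, 0, 0) (0, j, 0, 0) = (0, 0, A.cross j j, 0) := by
  simp [brace, bmul, binv, cross_zero_right, tb_zero_left, tb_zero_right]

lemma brace_upper_upper (j k : A.M) :
    A.brace 1 (0, j, 0, 0) (0, k, 0, 0) (0, j, 0, 0) =
      (0, 0, 0, 2 * A.tb j (A.cross j k) - A.tb k (A.cross j j)) := by
  simp [brace, bmul, binv, cross_zero_left, cross_zero_right, tb_zero_right, two_mul]

lemma tb_comm (x y : A.M) : A.tb x y = A.tb y x := by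
  rw [tb, tb, jmul, jmul, add_comm]

end Identities

section InnerIdeal

variable {F : Type u} [Field F] {A : ReducedAlbert.{u, v} F} {I : Submodule F A.Bam}

lemma IsInnerIdeal.upper_mem (hI : A.IsInnerIdeal 1 I) (h2 : (2 : F) ≠ 0)
    (h : ∀ j ∈ A.J, ((0, 0, j, 0) : A.Bam) ∈ I) :
    ∀ j ∈ A.J, ((0, j, 0, 0) : A.Bam) ∈ I := by
  refine J_le_of_sharp_mem A h2
    (I.comap (LinearMap.inr F F _ ∘ₗ LinearMap.inl F A.M (A.M × F))) fun j hj => ?_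
  have := hI.2 _ (h j hj) (0, 0, 0, 1) ⟨A.J.zero_mem, A.J.zero_mem⟩
  rw [brace_lower_scalar, cross_self] at this
  refine (I.smul_mem_iff h2).1 (?_ : (2 : F) • ((0, A.sharp j, 0, 0) : A.Bam) ∈ I)
  simpa only [Prod.smul_mk, smul_zero] using this

lemma IsInnerIdeal.lower_mem (hI : A.IsInnerIdeal 1 I) (h2 : (2 : F) ≠ 0)
    (h : ∀ j ∈ A.J, ((0, j, 0, 0) : A.Bam) ∈ I) :
    ∀ j ∈ A.J, ((0, 0, j, 0) : A.Bam) ∈ I := by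
  refine J_le_of_sharp_mem A h2
    (I.comap (LinearMap.inr F F _ ∘ₗ LinearMap.inr F A.M (A.M × F) ∘ₗ LinearMap.inl F A.M F))
    fun j hj => ?_
  have := hI.2 _ (h j hj) (1, 0, 0, 0) ⟨A.J.zero_mem, A.J.zero_mem⟩
  rw [brace_upper_scalar, cross_self] at this
  refine (I.smul_mem_iff h2).1 (?_ : (2 : F) • ((0, 0, A.sharp j, 0) : A.Bam) ∈ I)
  simpa only [Prod.smul_mk, smul_zero] using this

lemma IsInnerIdeal.eq_Bsub (hI : A.IsInnerIdeal 1 I) (h2 : (2 : F) ≠ 0) (h3 : (3 : F) ≠ 0)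
    (hl : ∀ j ∈ A.J, ((0, 0, j, 0) : A.Bam) ∈ I)
    (hu : ∀ j ∈ A.J, ((0, j, 0, 0) : A.Bam) ∈ I) : I = A.Bsub := by
  have h6 : 2 * 6 - 6 = (2 * 3 : F) := by norm_num
  have hne : (2 * 3 : F) ≠ 0 := mul_ne_zero h2 h3
  have hα : ((1, 0, 0, 0) : A.Bam) ∈ I := by
    have := hI.2 _ (hl 1 A.one_mem_J) (0, 0, 1, 0) ⟨A.J.zero_mem, A.one_mem_J⟩
    rw [brace_lower_lower, tb_cross_one_one A h2, h6] at this
    refine (I.smul_mem_iff hne).1 ?_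
    simpa using this
  have hβ : ((0, 0, 0, 1) : A.Bam) ∈ I := by
    have := hI.2 _ (hu 1 A.one_mem_J) (0, 1, 0, 0) ⟨A.one_mem_J, A.J.zero_mem⟩
    rw [brace_upper_upper, tb_comm, tb_cross_one_one A h2, h6] at this
    refine (I.smul_mem_iff hne).1 ?_
    simpa using this
  refine le_antisymm hI.1 ?_
  rintro ⟨α, j, k, β⟩ ⟨hj, hk⟩
  have := I.add_mem (I.add_mem (I.smul_mem α hα) (hu j hj))
    (I.add_mem (hl k hk) (I.smul_mem β hβ))
  simpa using this

end InnerIdeal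

end ReducedAlbert

/-- If an inner ideal `I` of `B(J,F×F)` contains `{(0,0;j',0) : j' ∈ J}` or
`{(0,j;0,0) : j ∈ J}`, then `I` is all of `B(J,F×F)`. -/
theorem stmt16 {F : Type u} [Field F] (h2 : (2 : F) ≠ 0) (h3 : (3 : F) ≠ 0)
    (A : ReducedAlbert.{u, v} F) (I : Submodule F A.Bam) (hI : A.IsInnerIdeal 1 I)
    (hcontains :
      (∀ j' ∈ A.J, (((0 : F), (0 : A.M), j', (0 : F)) : A.Bam) ∈ I) ∨
      (∀ j ∈ A.J, (((0 : F), j, (0 : A.M), (0 : F)) : A.Bam) ∈ I)) :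
    I = A.Bsub := by
  rcases hcontains with h | h
  · exact hI.eq_Bsub h2 h3 h (hI.upper_mem h2 h)
  · exact hI.eq_Bsub h2 h3 (hI.lower_mem h2 h) h
end
end
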